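/- arXiv:2206.01106 — 4 statements merged into one kernel-verified Lean document; each statement's English description precedes it below -/
import Mathlib

section
/- Under uniform label noise with c classes and noise level ε satisfying 0 ≤ ε < (c−1)/c, for every pair of classes k, j one has m_k > m_j if and only if m*_k > m*_j, where m_k = (1 − cε/(c−1))·m*_k + ε/(c−1). Consequently the set of maximizers of the noisy posterior equals the set of maximizers of the clean posterior, so the Bayes optimal classifier trained on noisy labels predicts the same classes as the one trained on clean labels. -/
/-- Under uniform label noise with `c` classes and noise level `0 ≤ ε < (c−1)/c`,
for every pair of classes `k, j`, `m k > m j ↔ m* k > m* j`, where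
`m k = (1 − cε/(c−1))·m* k + ε/(c−1)`. Consequently the set of maximizers of
the noisy posterior equals the set of maximizers of the clean posterior:
the Bayes optimal classifier trained on noisy labels predicts the same classes
as the one trained on clean labels. -/
theorem uniform_noise_preserves_order_below_tipping
    (c : ℕ) (hc : 2 ≤ c) (ε : ℝ) (hε0 : 0 ≤ ε) (hε1 : ε < ((c : ℝ) - 1) / (c : ℝ))
    (mstar : Fin c → ℝ) (hnn : ∀ k, 0 ≤ mstar k) (hsum : ∑ k, mstar k = 1)
    (m : Fin c → ℝ)
    (hm : ∀ k, m k = (1 - (c : ℝ) * ε / ((c : ℝ) - 1)) * mstar k + ε / ((c : ℝ) - 1)) :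
    (∀ k j, m k > m j ↔ mstar k > mstar j) ∧
    {k : Fin c | ∀ j, m j ≤ m k} = {k : Fin c | ∀ j, mstar j ≤ mstar k} := by
  have hc2 : (2 : ℝ) ≤ c := by exact_mod_cast hc
  have slope_pos : 0 < 1 - (c : ℝ) * ε / ((c : ℝ) - 1) := by
    rw [lt_div_iff₀ (by linarith)] at hε1
    rw [sub_pos, div_lt_one (by linarith)]
    linarith
  have order : ∀ k j, m k > m j ↔ mstar k > mstar j := fun k j => by
    rw [hm k, hm j, gt_iff_lt, gt_iff_lt, add_lt_add_iff_right, mul_lt_mul_iff_right₀ slope_pos]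
  refine ⟨order, Set.ext fun k => forall_congr' fun j => ?_⟩
  simpa only [gt_iff_lt, not_lt] using not_congr (order j k)
end

section
/- For spread s, if m̄ > 1/(s+1), then the class-dependent noisy accuracy q_s(ε) = m̄·(1 − ε(s+1)/s)² + (ε/s)·(2 − ε(s+1)/s) satisfies q_s(ε) ≥ 1/(s+1) for all ε ∈ [0,1], with equality if and only if ε = s/(s+1); i.e., the minimum noisy accuracy of 1/(s+1) occurs exactly at the tipping point ε = s/(s+1), which can be as low as 1/2 when s = 1. -/
/-- For spread `s`, if `m̄ > 1/(s+1)`, then the class-dependent noisy accuracy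
`q_s(ε) = m̄·(1 − ε(s+1)/s)² + (ε/s)·(2 − ε(s+1)/s)` satisfies
`q_s(ε) ≥ 1/(s+1)` for all `ε ∈ [0,1]`, with equality iff `ε = s/(s+1)`:
the minimum noisy accuracy of `1/(s+1)` occurs exactly at the tipping point
`ε = s/(s+1)`, which can be as low as `1/2` when `s = 1`. -/
theorem class_dependent_noise_tipping_point
    (s : ℕ) (hs : 1 ≤ s) (mbar : ℝ) (hmbar : 1 / ((s : ℝ) + 1) < mbar)
    (q : ℝ → ℝ)
    (hq : ∀ ε : ℝ, q ε = mbar * (1 - ε * ((s : ℝ) + 1) / (s : ℝ)) ^ 2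
        + (ε / (s : ℝ)) * (2 - ε * ((s : ℝ) + 1) / (s : ℝ))) :
    ∀ ε ∈ Set.Icc (0 : ℝ) 1,
      1 / ((s : ℝ) + 1) ≤ q ε ∧ (q ε = 1 / ((s : ℝ) + 1) ↔ ε = (s : ℝ) / ((s : ℝ) + 1)) := by
  have hs0 : (0 : ℝ) < s := by exact_mod_cast hs
  have hs1 : (s : ℝ) + 1 ≠ 0 := by positivity
  intro ε _
  have key : q ε = 1 / ((s : ℝ) + 1)
      + (mbar - 1 / ((s : ℝ) + 1)) * (1 - ε * ((s : ℝ) + 1) / (s : ℝ)) ^ 2 := by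
    rw [hq]
    field_simp
    ring
  have hm : 0 < mbar - 1 / ((s : ℝ) + 1) := sub_pos.mpr hmbar
  refine ⟨?_, ?_⟩
  · rw [key]
    exact le_add_of_nonneg_right (by positivity)
  · rw [key, add_eq_left, mul_eq_zero_iff_left hm.ne', sq_eq_zero_iff, sub_eq_zero,
      eq_div_iff hs0.ne', eq_div_iff hs1, one_mul, eq_comm]
end

section
/- Fix a point x with clean posterior m* on c classes where the true label k is the unique clean Bayes prediction, i.e. m*_k > m*_i for all i ≠ k, and m*_k > 0. Let j* ∈ argmax_{i≠k} m*_i and flip the label at x to j* with probability p ∈ [0,1], giving noisy posteriors m_k = (1−p)·m*_k, m_{j*} = m*_{j*} + p·m*_k, and m_i = m*_i otherwise. Then the Bayes optimal classifier on the noisy distribution misclassifies x — that is, m_k < max_{i≠k} m_i — if and only if p > (m*_k − m*_{j*}) / (2·m*_k). Hence samples near the clean decision boundary (small margin m*_k − m*_{j*}) are flipped into errors by arbitrarily small noise levels. -/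
/-- Fix a point with clean posterior `m*` on `c` classes where the true label
`k` is the unique clean Bayes prediction (`m* k > m* i` for all `i ≠ k`) and
`m* k > 0`. Let `j* ∈ argmax_{i≠k} m* i` and flip the label to `j*` with
probability `p ∈ [0,1]`, giving noisy posteriors `m k = (1−p)·m* k`,
`m j* = m* j* + p·m* k`, and `m i = m* i` otherwise. Then the Bayes optimal
classifier on the noisy distribution misclassifies this point — i.e.
`m k < max_{i≠k} m i` — iff `p > (m* k − m* j*) / (2·m* k)`. Hence samples
near the clean decision boundary (small margin) are flipped into errors by
arbitrarily small noise levels. -/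
theorem boundary_flip_misclassification_threshold
    (c : ℕ) (hc : 2 ≤ c)
    (mstar : Fin c → ℝ) (hnn : ∀ k, 0 ≤ mstar k) (hsum : ∑ k, mstar k = 1)
    (k : Fin c) (hkmax : ∀ i, i ≠ k → mstar i < mstar k) (hkpos : 0 < mstar k)
    (p : ℝ) (hp : p ∈ Set.Icc (0 : ℝ) 1)
    (jstar : Fin c) (hjstar : jstar ≠ k) (hjmax : ∀ i, i ≠ k → mstar i ≤ mstar jstar)
    (m : Fin c → ℝ)
    (hm : ∀ i, m i = if i = k then (1 - p) * mstar k
        else mstar i + (if i = jstar then p * mstar k else 0)) :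
    (∃ i, i ≠ k ∧ m k < m i) ↔ (mstar k - mstar jstar) / (2 * mstar k) < p := by
  have hmk : m k = (1 - p) * mstar k := by simp [hm]
  have hmj : m jstar = mstar jstar + p * mstar k := by simp [hm, hjstar]
  have hflip : 0 ≤ p * mstar k := mul_nonneg hp.1 hkpos.le
  have hmax : ∀ i, i ≠ k → m i ≤ m jstar := by
    intro i hi
    rw [hmj, hm i, if_neg hi]
    have := hjmax i hi
    split_ifs <;> linarith
  have hexists : (∃ i, i ≠ k ∧ m k < m i) ↔ m k < m jstar :=
    ⟨fun ⟨i, hi, hlt⟩ => hlt.trans_le (hmax i hi), fun hlt => ⟨jstar, hjstar, hlt⟩⟩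
  rw [hexists, hmk, hmj, div_lt_iff₀ (by positivity)]
  constructor <;> intro h <;> linarith
end

section
/- For c classes, if m̄ > 1/c, then the uniform-noise noisy accuracy q(ε) = m̄·(1 − cε/(c−1))² + (ε/(c−1))·(2 − cε/(c−1)) is strictly decreasing on the interval [0, (c−1)/c]: for all 0 ≤ ε₁ < ε₂ ≤ (c−1)/c, q(ε₂) < q(ε₁). -/
/-- For `c` classes, if `m̄ > 1/c`, then the uniform-noise noisy accuracy
`q(ε) = m̄·(1 − cε/(c−1))² + (ε/(c−1))·(2 − cε/(c−1))` is strictly decreasing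
on `[0, (c−1)/c]`: for all `0 ≤ ε₁ < ε₂ ≤ (c−1)/c`, `q ε₂ < q ε₁`. -/
theorem uniform_noise_noisy_accuracy_strict_anti
    (c : ℕ) (hc : 2 ≤ c) (mbar : ℝ) (hmbar : 1 / (c : ℝ) < mbar)
    (q : ℝ → ℝ)
    (hq : ∀ ε : ℝ, q ε = mbar * (1 - (c : ℝ) * ε / ((c : ℝ) - 1)) ^ 2
        + (ε / ((c : ℝ) - 1)) * (2 - (c : ℝ) * ε / ((c : ℝ) - 1))) :
    ∀ ε₁ ε₂ : ℝ, 0 ≤ ε₁ → ε₁ < ε₂ → ε₂ ≤ ((c : ℝ) - 1) / (c : ℝ) → q ε₂ < q ε₁ := by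
  intro ε₁ ε₂ _ hlt hle
  have hc' : (2 : ℝ) ≤ c := by exact_mod_cast hc
  have hc0 : (0 : ℝ) < c := by linarith
  have hc1 : (0 : ℝ) < (c : ℝ) - 1 := by linarith
  have completed_square (ε : ℝ) :
      q ε = (mbar - 1 / c) * (1 - (c : ℝ) * ε / ((c : ℝ) - 1)) ^ 2 + 1 / c := by
    rw [hq]
    field_simp
    ring
  have hscaled_lt : (c : ℝ) * ε₁ / ((c : ℝ) - 1) < (c : ℝ) * ε₂ / ((c : ℝ) - 1) := by
    gcongr
  have hscaled_le : (c : ℝ) * ε₂ / ((c : ℝ) - 1) ≤ 1 := by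
    rw [div_le_one hc1, mul_comm]
    exact (le_div_iff₀ hc0).mp hle
  rw [completed_square, completed_square]
  have hsq : (1 - (c : ℝ) * ε₂ / ((c : ℝ) - 1)) ^ 2
      < (1 - (c : ℝ) * ε₁ / ((c : ℝ) - 1)) ^ 2 :=
    pow_lt_pow_left₀ (by linarith) (by linarith) two_ne_zero
  have := mul_lt_mul_of_pos_left hsq (sub_pos.mpr hmbar)
  linarith
end
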